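/- Let K = n·Σ_{i=1}^n Σ_{j=1}^m |u_i(j)| + 1 and fix reals ε_{ij} with 0 < ε_{ij} < 1/(K·n²·m) for all i ∈ [n], j ∈ [m]. For t in the (n−1)-dimensional standard simplex, let W_t(A) = (1/K)·Σ_{i=1}^n (1 + (K−n)·t_i)·u_i(A_i) + Σ_{i=1}^n Σ_{j∈A_i} ε_{ij}. Then there exists a point t* of the simplex such that for every agent i there is a feasible allocation maximizing W_{t*} over all feasible allocations that is envy-free for agent i. -/

import Mathlib

/-- Bundle of agent `i'` under allocation `A`. -/
def bundle {n m : ℕ} (A : Fin m → Fin n) (i' : Fin n) : Finset (Fin m) :=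
  Finset.univ.filter (fun j => A j = i')

/-- Utility of agent `i` for the bundle of agent `i'` under allocation `A`. -/
def util {n m : ℕ} (u : Fin n → Fin m → ℤ) (A : Fin m → Fin n) (i i' : Fin n) : ℤ :=
  ∑ j ∈ bundle A i', u i j

/-- An allocation is feasible if each agent gets at most `s h` items from category `h`. -/
def IsFeasible {n m k : ℕ} (cat : Fin m → Fin k) (s : Fin k → ℕ) (A : Fin m → Fin n) : Prop :=
  ∀ (i : Fin n) (h : Fin k), ((bundle A i).filter (fun j => cat j = h)).card ≤ s h

/-- A feasible allocation is Pareto-optimal if no feasible allocation Pareto-dominates it. -/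
def IsParetoOptimal {n m k : ℕ} (u : Fin n → Fin m → ℤ) (cat : Fin m → Fin k)
    (s : Fin k → ℕ) (A : Fin m → Fin n) : Prop :=
  IsFeasible cat s A ∧
    ¬ ∃ A' : Fin m → Fin n, IsFeasible cat s A' ∧
        (∀ i, util u A i i ≤ util u A' i i) ∧ (∃ i, util u A i i < util u A' i i)

/-- The objective `W(A) = (1/K)·Σ_i (1 + (K−n)·t_i)·u_i(A_i) + Σ_i Σ_{j∈A_i} ε_{ij}`. -/
noncomputable def objW {n m : ℕ} (u : Fin n → Fin m → ℤ) (K : ℤ) (t : Fin n → ℝ) (ε : Fin n → Fin m → ℝ)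
    (A : Fin m → Fin n) : ℝ :=
  (1 / (K : ℝ)) * ∑ i, (1 + ((K : ℝ) - (n : ℝ)) * t i) * (util u A i i : ℝ)
    + ∑ i, ∑ j ∈ bundle A i, ε i j


/-- An allocation is envy-free for agent `i` if `i` envies no agent. -/
def EnvyFreeFor {n m : ℕ} (u : Fin n → Fin m → ℤ) (A : Fin m → Fin n) (i : Fin n) : Prop :=
  ∀ i', util u A i i' ≤ util u A i i

/-- A finite set `S` is dominant with respect to a family of rankings `r` if no point strictly
exceeds, in every ranking, the minimum of `S`. -/
def Dominant {Y I : Type*} (r : I → Y → ℕ) (S : Finset Y) : Prop :=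
  ∀ y, ∃ i, ∀ x ∈ S, r i y ≤ r i x

theorem Dominant.mono {Y I : Type*} {r : I → Y → ℕ} {S T : Finset Y} (hS : Dominant r S)
    (h : T ⊆ S) : Dominant r T := fun y => by
  obtain ⟨i, hi⟩ := hS y
  exact ⟨i, fun x hx => hi x (h hx)⟩

/-- In a dominant set with as many points as rankings, each point is the minimum of exactly one
ranking. -/
theorem Dominant.exists_argmin {Y I : Type*} [Fintype I] {r : I → Y → ℕ} {S : Finset Y}
    (hr : ∀ i, Function.Injective (r i)) (hS : Dominant r S) (hcard : S.card = Fintype.card I) :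
    ∃ e : I → Y, (∀ i, e i ∈ S) ∧ (∀ i, ∀ x ∈ S, r i (e i) ≤ r i x) ∧
      Function.Injective e ∧ ∀ y ∈ S, ∃ i, e i = y := by
  classical
  choose p hp using hS
  have hinj : Set.InjOn p S := fun x hx y hy hxy =>
    hr (p x) (le_antisymm (hp x y hy) (by have := hp y x hx; rwa [← hxy] at this))
  have himg : S.image p = Finset.univ :=
    Finset.eq_univ_of_card _ (by rw [Finset.card_image_of_injOn hinj, hcard])
  have hsurj : ∀ i, ∃ y ∈ S, p y = i := fun i => by
    have := Finset.mem_univ i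
    rwa [← himg, Finset.mem_image] at this
  choose e heS he using hsurj
  refine ⟨e, heS, fun i x hx => ?_, fun i j hij => ?_, fun y hy => ⟨p y, ?_⟩⟩
  · have := hp (e i) x hx
    rwa [he] at this
  · rw [← he i, ← he j, hij]
  · exact hinj (heS _) hy (he _)

/-- A set with one point fewer than there are rankings extends to a dominant set in an even number
of ways, provided that it is nonempty and bounded away from the boundary in the sense of `hY`. -/
theorem even_card_dominant_insert {Y I : Type*} [Fintype Y] [DecidableEq Y] [Fintype I]
    {r : I → Y → ℕ} (hr : ∀ i, Function.Injective (r i)) {T : Finset Y}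
    (hcard : T.card + 1 = Fintype.card I) (hT : T.Nonempty)
    (hY : ∀ j, ∃ y, ∀ i, i ≠ j → ∃ x ∈ T, r i x < r i y)
    [DecidablePred fun y => y ∉ T ∧ Dominant r (insert y T)] :
    Even (Finset.univ.filter fun y => y ∉ T ∧ Dominant r (insert y T)).card := by
  classical
  rcases (Finset.univ.filter fun y => y ∉ T ∧ Dominant r (insert y T)).eq_empty_or_nonempty with
    h0 | ⟨y₀, hy₀⟩
  · rw [h0]; simp
  simp only [Finset.mem_filter, Finset.mem_univ, true_and] at hy₀
  obtain ⟨hy₀T, hdom⟩ := hy₀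
  have hdomT : Dominant r T := hdom.mono (Finset.subset_insert _ _)
  obtain ⟨e, heS, hemin, heinj, hesurj⟩ := hdom.exists_argmin hr
    (by rw [Finset.card_insert_of_notMem hy₀T, hcard])
  obtain ⟨a, ha⟩ := hesurj y₀ (Finset.mem_insert_self _ _)
  have heT : ∀ i, i ≠ a → e i ∈ T := fun i hi => by
    rcases Finset.mem_insert.1 (heS i) with h | h
    · exact absurd (heinj (h.trans ha.symm)) hi
    · exact h
  obtain ⟨b₀, hb₀T, hb₀⟩ := T.exists_min_image (r a) hT
  obtain ⟨b, hb⟩ := hesurj b₀ (Finset.mem_insert_of_mem hb₀T)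
  have hab : a ≠ b := by
    rintro rfl
    exact hy₀T (by rw [← ha, hb]; exact hb₀T)
  have hmin : ∀ j, j = a ∨ j = b → ∀ x ∈ T, ∃ i, i ≠ j ∧ ∀ x' ∈ T, r i x ≤ r i x' := by
    intro j hj x hx
    obtain ⟨i, rfl⟩ := hesurj x (Finset.mem_insert_of_mem hx)
    by_cases hij : i = j
    · subst hij
      rcases hj with rfl | rfl
      · exact absurd (ha ▸ hx) hy₀T
      · exact ⟨a, hab, hb ▸ hb₀⟩
    · exact ⟨i, hij, fun x' hx' => hemin i x' (Finset.mem_insert_of_mem hx')⟩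
  have hmax : ∀ j, ∃ w, (∀ i, i ≠ j → ∃ x ∈ T, r i x < r i w) ∧
      ∀ z, (∀ i, i ≠ j → ∃ x ∈ T, r i x < r i z) → r j z ≤ r j w := by
    intro j
    obtain ⟨y, hy⟩ := hY j
    obtain ⟨w, hw, hwmax⟩ := (Finset.univ.filter
      fun y => ∀ i, i ≠ j → ∃ x ∈ T, r i x < r i y).exists_max_image (r j) ⟨y, by simpa using hy⟩
    exact ⟨w, (Finset.mem_filter.1 hw).2, fun z hz => hwmax z (by simpa using hz)⟩
  choose w hw hwmax using hmax
  have hnot : ∀ y, ¬ ∀ i, ∃ x ∈ T, r i x < r i y := by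
    intro y hy
    obtain ⟨i, hi⟩ := hdomT y
    obtain ⟨x, hx, hlt⟩ := hy i
    exact absurd (hi x hx) (not_le.2 hlt)
  have hwroom : ∀ j, j = a ∨ j = b → w j ∉ T ∧ Dominant r (insert (w j) T) := by
    intro j hj
    refine ⟨fun hwT => ?_, fun z => ?_⟩
    · obtain ⟨i, hij, hi⟩ := hmin j hj _ hwT
      obtain ⟨x, hx, hlt⟩ := hw j i hij
      exact absurd (hi x hx) (not_le.2 hlt)
    · by_contra! hz
      have hzj : ∀ i, i ≠ j → ∃ x ∈ T, r i x < r i z := by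
        intro i hij
        obtain ⟨x, hx, hlt⟩ := hz i
        rcases Finset.mem_insert.1 hx with rfl | hx
        · obtain ⟨x', hx', hlt'⟩ := hw j i hij
          exact ⟨x', hx', hlt'.trans hlt⟩
        · exact ⟨x, hx, hlt⟩
      have hle := hwmax j z hzj
      obtain ⟨x, hx, hlt⟩ := hz j
      rcases Finset.mem_insert.1 hx with rfl | hxT
      · exact absurd hle (not_le.2 hlt)
      · refine hnot (w j) fun i => ?_
        by_cases hij : i = j
        · rw [hij]; exact ⟨x, hxT, hlt.trans_le hle⟩
        · exact hw j i hij
  have hne : w a ≠ w b := by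
    intro h
    refine hnot (w a) fun i => ?_
    by_cases hia : i = a
    · rw [h]; exact hw b i (hia ▸ hab)
    · exact hw a i hia
  have hset : (Finset.univ.filter fun y => y ∉ T ∧ Dominant r (insert y T)) = {w a, w b} := by
    ext y
    simp only [Finset.mem_filter, Finset.mem_univ, true_and, Finset.mem_insert,
      Finset.mem_singleton]
    constructor
    · rintro ⟨hyT, hy⟩
      obtain ⟨e', heS', hemin', heinj', hesurj'⟩ := hy.exists_argmin hr
        (by rw [Finset.card_insert_of_notMem hyT, hcard])
      obtain ⟨j, hj⟩ := hesurj' y (Finset.mem_insert_self _ _)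
      have heT' : ∀ i, i ≠ j → e' i ∈ T := fun i hi => by
        rcases Finset.mem_insert.1 (heS' i) with h | h
        · exact absurd (heinj' (h.trans hj.symm)) hi
        · exact h
      have hyw : y = w j := by
        refine hr j (le_antisymm (hwmax j y fun i hij => ⟨e' i, heT' i hij, ?_⟩) ?_)
        · refine lt_of_le_of_ne (hemin' i y (Finset.mem_insert_self _ _)) fun h => ?_
          exact hyT (hr i h ▸ heT' i hij)
        · obtain ⟨i, hi⟩ := hy (w j)
          by_cases hij : i = j
          · subst hij; exact hi y (Finset.mem_insert_self _ _)
          · obtain ⟨x, hx, hlt⟩ := hw j i hij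
            exact absurd (hi x (Finset.mem_insert_of_mem hx)) (not_le.2 hlt)
      by_cases hja : j = a
      · left; rw [hyw, hja]
      by_cases hjb : j = b
      · right; rw [hyw, hjb]
      exfalso
      have h1 : e' a = b₀ := hr a (le_antisymm
        (hemin' a b₀ (Finset.mem_insert_of_mem hb₀T)) (hb₀ _ (heT' a (Ne.symm hja))))
      have h2 : e' b = b₀ := hr b (le_antisymm
        (hemin' b b₀ (Finset.mem_insert_of_mem hb₀T))
        (hb ▸ hemin b _ (Finset.mem_insert_of_mem (heT' b (Ne.symm hjb)))))
      exact hab (heinj' (h1.trans h2.symm))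
    · rintro (rfl | rfl)
      · exact hwroom a (Or.inl rfl)
      · exact hwroom b (Or.inr rfl)
  rw [hset, Finset.card_pair hne]
  exact even_two

/-- If the colours of `S` are not exhausted, an even number of points of `S` can be removed so that
exactly the colour `i₀` is missing. -/
theorem even_card_erase_image {Y I : Type*} [DecidableEq Y] [Fintype I] [DecidableEq I]
    (c : Y → I) (i₀ : I) {S : Finset Y} (hcard : S.card = Fintype.card I)
    (hS : S.image c ≠ Finset.univ) :
    Even (S.filter fun x => (S.erase x).image c = Finset.univ.erase i₀).card := by
  rcases (S.filter fun x => (S.erase x).image c = Finset.univ.erase i₀).eq_empty_or_nonempty with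
    h0 | ⟨x₀, hx₀⟩
  · rw [h0]; simp
  obtain ⟨hx₀S, hx₀⟩ := Finset.mem_filter.1 hx₀
  have hinj : ∀ x ∈ S, (S.erase x).image c = Finset.univ.erase i₀ →
      Set.InjOn c (S.erase x) := fun x hx h => by
    rw [← Finset.card_image_iff, h, Finset.card_erase_of_mem (Finset.mem_univ _),
      Finset.card_erase_of_mem hx, hcard, Finset.card_univ]
  have hc : c x₀ ≠ i₀ := by
    intro h
    apply hS
    rw [← Finset.insert_erase hx₀S, Finset.image_insert, hx₀, h,
      Finset.insert_erase (Finset.mem_univ _)]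
  have hmem : c x₀ ∈ (S.erase x₀).image c := by rw [hx₀]; simp [hc]
  obtain ⟨x₁, hx₁, hcx⟩ := Finset.mem_image.1 hmem
  obtain ⟨hne, hx₁S⟩ := Finset.mem_erase.1 hx₁
  have hset : (S.filter fun x => (S.erase x).image c = Finset.univ.erase i₀) = {x₀, x₁} := by
    ext x
    simp only [Finset.mem_filter, Finset.mem_insert, Finset.mem_singleton]
    constructor
    · rintro ⟨hxS, hx⟩
      by_contra! h
      exact hne (hinj x hxS hx (by simpa [h.2.symm] using hx₁S) (by simpa [h.1.symm] using hx₀S) hcx)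
    · rintro (rfl | rfl)
      · exact ⟨hx₀S, hx₀⟩
      · refine ⟨hx₁S, ?_⟩
        rw [← hx₀]
        ext i
        simp only [Finset.mem_image, Finset.mem_erase]
        constructor
        · rintro ⟨y, ⟨hy, hyS⟩, rfl⟩
          by_cases h : y = x₀
          · exact ⟨x, ⟨hne, hx₁S⟩, by rw [h, hcx]⟩
          · exact ⟨y, ⟨h, hyS⟩, rfl⟩
        · rintro ⟨y, ⟨hy, hyS⟩, rfl⟩
          by_cases h : y = x
          · exact ⟨x₀, ⟨hne.symm, hx₀S⟩, by rw [h, hcx]⟩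
          · exact ⟨y, ⟨h, hyS⟩, rfl⟩
  rw [hset, Finset.card_pair hne.symm]
  exact even_two

/-- The parity argument: if exactly one of the sets missing only the colour `i₀` extends to a
dominant set in an odd number of ways, then some dominant set carries all colours. -/
theorem exists_dominant_image_eq_univ {Y I : Type*} [Fintype Y] [DecidableEq Y] [Fintype I]
    [DecidableEq I] {r : I → Y → ℕ} [DecidablePred (Dominant r)] (c : Y → I) (i₀ : I)
    (T₀ : Finset Y)
    (hT₀ : T₀.card + 1 = Fintype.card I) (hcT₀ : T₀.image c = Finset.univ.erase i₀)
    (hodd : Odd (Finset.univ.filter fun y => y ∉ T₀ ∧ Dominant r (insert y T₀)).card)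
    (heven : ∀ T : Finset Y, T.card + 1 = Fintype.card I → T.image c = Finset.univ.erase i₀ →
      T ≠ T₀ → Even (Finset.univ.filter fun y => y ∉ T ∧ Dominant r (insert y T)).card) :
    ∃ S : Finset Y, S.card = Fintype.card I ∧ Dominant r S ∧ S.image c = Finset.univ := by
  by_contra! hcon
  let R : Finset (Finset Y) :=
    Finset.univ.filter fun S => S.card = Fintype.card I ∧ Dominant r S
  let D : Finset (Finset Y) :=
    Finset.univ.filter fun T => T.card + 1 = Fintype.card I ∧ T.image c = Finset.univ.erase i₀
  have hcount := Finset.sum_card_bipartiteAbove_eq_sum_card_bipartiteBelow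
    (s := D) (t := R) (fun T S => T ⊆ S)
  have hbelow : ∀ S ∈ R, Even (D.bipartiteBelow (fun T S => T ⊆ S) S).card := by
    intro S hS
    simp only [R, Finset.mem_filter, Finset.mem_univ, true_and] at hS
    have := even_card_erase_image c i₀ hS.1 (hcon S hS.1 hS.2)
    convert this using 1
    symm
    refine Finset.card_bij (fun x _ => S.erase x) ?_ ?_ ?_
    · intro x hx
      obtain ⟨hxS, hx⟩ := Finset.mem_filter.1 hx
      simp only [Finset.bipartiteBelow, D, Finset.mem_filter, Finset.mem_univ, true_and]
      exact ⟨⟨by rw [Finset.card_erase_add_one hxS, hS.1], hx⟩, Finset.erase_subset _ _⟩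
    · intro x hx y hy h
      exact (Finset.erase_inj S (Finset.mem_filter.1 hx).1).1 h
    · intro T hT
      simp only [Finset.bipartiteBelow, D, Finset.mem_filter, Finset.mem_univ, true_and] at hT
      obtain ⟨⟨hTc, hTi⟩, hTS⟩ := hT
      have hex : ∃ x ∉ T, insert x T = S :=
        Finset.exists_eq_insert_iff.2 ⟨hTS, by rw [hTc, hS.1]⟩
      obtain ⟨x, hxT, rfl⟩ := hex
      have h := Finset.erase_insert hxT
      exact ⟨x, Finset.mem_filter.2 ⟨Finset.mem_insert_self _ _, by rw [h, hTi]⟩, h⟩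
  have habove : ∀ T ∈ D, (R.bipartiteAbove (fun T S => T ⊆ S) T).card =
      (Finset.univ.filter fun y => y ∉ T ∧ Dominant r (insert y T)).card := by
    intro T hT
    simp only [D, Finset.mem_filter, Finset.mem_univ, true_and] at hT
    symm
    refine Finset.card_bij (fun y _ => insert y T) ?_ ?_ ?_
    · intro y hy
      simp only [Finset.mem_filter, Finset.mem_univ, true_and] at hy
      simp only [Finset.bipartiteAbove, R, Finset.mem_filter, Finset.mem_univ, true_and]
      exact ⟨⟨by rw [Finset.card_insert_of_notMem hy.1, hT.1], hy.2⟩, Finset.subset_insert _ _⟩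
    · intro x hx y hy h
      simp only [Finset.mem_filter, Finset.mem_univ, true_and] at hx
      exact (Finset.insert_inj hx.1).1 h
    · intro S hS
      simp only [Finset.bipartiteAbove, R, Finset.mem_filter, Finset.mem_univ, true_and] at hS
      obtain ⟨⟨hSc, hSd⟩, hTS⟩ := hS
      have hex : ∃ x ∉ T, insert x T = S :=
        Finset.exists_eq_insert_iff.2 ⟨hTS, by rw [hSc, hT.1]⟩
      obtain ⟨x, hxT, rfl⟩ := hex
      exact ⟨x, by simpa using ⟨hxT, hSd⟩, rfl⟩
  have hT₀D : T₀ ∈ D := by simp [D, hT₀, hcT₀]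
  have h1 : Even (∑ T ∈ D, (R.bipartiteAbove (fun T S => T ⊆ S) T).card) := by
    rw [hcount]; exact Finset.even_sum _ hbelow
  rw [← Finset.add_sum_erase _ _ hT₀D, habove T₀ hT₀D] at h1
  have h2 : Even (∑ T ∈ D.erase T₀, (R.bipartiteAbove (fun T S => T ⊆ S) T).card) := by
    refine Finset.even_sum _ fun T hT => ?_
    obtain ⟨hne, hTD⟩ := Finset.mem_erase.1 hT
    rw [habove T hTD]
    simp only [D, Finset.mem_filter, Finset.mem_univ, true_and] at hTD
    exact heven T hTD.1 hTD.2 hne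
  exact (Nat.not_even_iff_odd.2 (hodd.add_even h2)) h1

/-- Extend the rankings `ρ` of `X` to `X ⊕ I`: the new point `i` comes last in the ranking `i` and
before all points of `X` in the other rankings, where `M` is a strict upper bound for `ρ`. -/
def slackRank {X I : Type*} [DecidableEq I] (ρ : I → X → ℕ) (M : ℕ) (idx : I → ℕ) (i : I) :
    X ⊕ I → ℕ
  | Sum.inl x => ρ i x + 1
  | Sum.inr j => if j = i then 0 else M + 1 + idx j

theorem slackRank_injective {X I : Type*} [DecidableEq I] {ρ : I → X → ℕ} {M : ℕ} {idx : I → ℕ}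
    (hρ : ∀ i, Function.Injective (ρ i)) (hM : ∀ i x, ρ i x < M) (hidx : Function.Injective idx)
    (i : I) : Function.Injective (slackRank ρ M idx i) := by
  rintro (x | j) (y | l) h
  · simp only [slackRank, add_left_inj] at h
    rw [hρ i h]
  · have := hM i x
    simp only [slackRank] at h
    split_ifs at h; all_goals omega
  · have := hM i y
    simp only [slackRank] at h
    split_ifs at h; all_goals omega
  · simp only [slackRank] at h
    split_ifs at h with h1 h2 h2
    · rw [h1, h2]
    · omega
    · omega
    · rw [hidx (by omega : idx j = idx l)]

/-- **Scarf's lemma**: for every colouring of a finite set ranked in the ways `i : I` by the colours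
`I` there is a dominant set of points and slack points carrying all colours. -/
theorem exists_dominant_slackRank {X I : Type*} [Fintype X] [Nonempty X] [Fintype I]
    [DecidableEq X] [DecidableEq I] [Nonempty I] {ρ : I → X → ℕ} {M : ℕ} {idx : I → ℕ}
    (hρ : ∀ i, Function.Injective (ρ i)) (hM : ∀ i x, ρ i x < M) (hidx : Function.Injective idx)
    (c : X → I) :
    ∃ S : Finset (X ⊕ I), S.card = Fintype.card I ∧ Dominant (slackRank ρ M idx) S ∧
      S.image (Sum.elim c id) = Finset.univ := by
  classical
  obtain ⟨i₀⟩ := ‹Nonempty I›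
  have hr := slackRank_injective hρ hM hidx
  have hlow : ∀ i x, slackRank ρ M idx i (Sum.inr i) < slackRank ρ M idx i (Sum.inl x) :=
    fun i x => by simp [slackRank]
  have hhigh : ∀ i j x, j ≠ i →
      slackRank ρ M idx i (Sum.inl x) < slackRank ρ M idx i (Sum.inr j) :=
    fun i j x h => by have := hM i x; simp only [slackRank, if_neg h]; omega
  have hbot : ∀ i y, slackRank ρ M idx i (Sum.inr i) ≤ slackRank ρ M idx i y :=
    fun i y => by simp [slackRank]
  let T₀ : Finset (X ⊕ I) := (Finset.univ.erase i₀).image Sum.inr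
  have hT₀ : T₀.card + 1 = Fintype.card I := by
    rw [Finset.card_image_of_injective _ Sum.inr_injective,
      Finset.card_erase_add_one (Finset.mem_univ _), Finset.card_univ]
  have hmemT₀ : ∀ y, y ∈ T₀ ↔ ∃ j, j ≠ i₀ ∧ y = Sum.inr j := fun y => by
    simp [T₀, eq_comm]
  refine exists_dominant_image_eq_univ (Sum.elim c id) i₀ T₀ hT₀ ?_ ?_ ?_
  · rw [Finset.image_image]; simp
  · obtain ⟨w, -, hw⟩ := Finset.univ.exists_max_image (ρ i₀) Finset.univ_nonempty
    have hset : (Finset.univ.filter fun y => y ∉ T₀ ∧ Dominant (slackRank ρ M idx) (insert y T₀))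
        = {Sum.inl w} := by
      ext y
      simp only [Finset.mem_filter, Finset.mem_univ, true_and, Finset.mem_singleton]
      constructor
      · rintro ⟨hyT, hy⟩
        obtain ⟨i, hi⟩ := hy (Sum.inl w)
        have hii : i = i₀ := by
          by_contra hne
          exact absurd (hi (Sum.inr i) (Finset.mem_insert_of_mem ((hmemT₀ _).2 ⟨i, hne, rfl⟩)))
            (not_le.2 (hlow i w))
        subst hii
        have hle := hi y (Finset.mem_insert_self _ _)
        rcases y with x | j
        · simp only [slackRank, add_le_add_iff_right] at hle
          rw [hρ i (le_antisymm (hw x (Finset.mem_univ _)) hle)]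
        · by_cases hj : j = i
          · subst hj; exact absurd hle (not_le.2 (hlow j w))
          · exact absurd ((hmemT₀ _).2 ⟨j, hj, rfl⟩) hyT
      · rintro rfl
        refine ⟨fun h => ?_, fun z => ?_⟩
        · obtain ⟨j, -, hj⟩ := (hmemT₀ _).1 h
          cases hj
        · rcases z with x | j
          · refine ⟨i₀, fun y hy => ?_⟩
            rcases Finset.mem_insert.1 hy with rfl | hy
            · simpa [slackRank] using hw x (Finset.mem_univ _)
            · obtain ⟨j, hj, rfl⟩ := (hmemT₀ _).1 hy
              exact (hhigh i₀ j x hj).le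
          · exact ⟨j, fun y _ => hbot j y⟩
    rw [hset]; simp
  · intro T hT hcT hne
    have hx : ∃ x, Sum.inl x ∈ T := by
      by_contra! h
      refine hne (Finset.eq_of_subset_of_card_le (fun y hy => ?_) (by omega))
      rcases y with x | j
      · exact absurd hy (h x)
      · have : j ∈ T.image (Sum.elim c id) := Finset.mem_image.2 ⟨_, hy, rfl⟩
        rw [hcT] at this
        exact (hmemT₀ _).2 ⟨j, (Finset.mem_erase.1 this).1, rfl⟩
    obtain ⟨x, hx⟩ := hx
    exact even_card_dominant_insert hr hT ⟨_, hx⟩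
      fun j => ⟨Sum.inr j, fun i hij => ⟨_, hx, hhigh i j x hij.symm⟩⟩

/-- The discrete form of the fixed point theorem on the simplex: for every colouring of the lattice
points of a dilated simplex there is a small box which meets all colours, up to colours whose
coordinate is small on the box. -/
theorem exists_box_of_coloring {n : ℕ} (hn : 0 < n) (N : ℕ) (c : (Fin n → ℕ) → Fin n) :
    ∃ a x₀ : Fin n → ℕ, ∑ i, x₀ i = N ∧ (∀ l, a l ≤ x₀ l ∧ x₀ l < a l + n) ∧
      ∀ i, a i = 0 ∨ ∃ x : Fin n → ℕ, ∑ l, x l = N ∧ c x = i ∧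
        ∀ l, a l ≤ x l ∧ x l < a l + n := by
  classical
  have : Nonempty (Fin n) := ⟨⟨0, hn⟩⟩
  let X := {x : Fin n → Fin (N + 1) // ∑ i, (x i : ℕ) = N}
  have hmk : ∀ y : Fin n → ℕ, ∑ i, y i = N → ∃ x : X, ∀ i, (x.1 i : ℕ) = y i := by
    intro y hy
    have hle : ∀ i, y i < N + 1 := fun i =>
      Nat.lt_succ_of_le (hy ▸ Finset.single_le_sum (fun j _ => Nat.zero_le (y j)) (Finset.mem_univ i))
    exact ⟨⟨fun i => ⟨y i, hle i⟩, hy⟩, fun i => rfl⟩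
  have : Nonempty X := by
    obtain ⟨x, -⟩ := hmk (Pi.single ⟨0, hn⟩ N) (by simp)
    exact ⟨x⟩
  let e := Fintype.equivFin X
  let q := Fintype.card X
  let ρ : Fin n → X → ℕ := fun i x => (x.1 i : ℕ) * q + e x
  have hlt : ∀ i (x y : X), (x.1 i : ℕ) < y.1 i → ρ i x < ρ i y := by
    intro i x y h
    have h1 : (e x : ℕ) < q := (e x).2
    have h2 : ((x.1 i : ℕ) + 1) * q ≤ y.1 i * q := Nat.mul_le_mul_right _ h
    simp only [ρ]
    nlinarith
  have hρ : ∀ i, Function.Injective (ρ i) := by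
    intro i x y h
    have h1 : (x.1 i : ℕ) = y.1 i := by
      rcases lt_trichotomy (x.1 i : ℕ) (y.1 i) with h' | h' | h'
      · exact absurd h (hlt i x y h').ne
      · exact h'
      · exact absurd h (hlt i y x h').ne'
    simp only [ρ, h1, add_right_inj] at h
    exact e.injective (Fin.ext h)
  have hM : ∀ i x, ρ i x < (N + 1) * q := by
    intro i x
    have h1 : (e x : ℕ) < q := (e x).2
    have h2 : ((x.1 i : ℕ) + 1) * q ≤ (N + 1) * q := Nat.mul_le_mul_right _ (x.1 i).2
    simp only [ρ]
    nlinarith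
  obtain ⟨S, -, hdom, himg⟩ := exists_dominant_slackRank (idx := Fin.val) hρ hM
    Fin.val_injective (fun x => c fun i => x.1 i)
  have hcol : ∀ i, Sum.inr i ∉ S → ∃ x : X, Sum.inl x ∈ S ∧ c (fun l => x.1 l) = i := by
    intro i hi
    have := Finset.mem_univ i
    rw [← himg, Finset.mem_image] at this
    obtain ⟨y | j, hy, hyi⟩ := this
    · exact ⟨y, hy, hyi⟩
    · simp only [Sum.elim_inr, id] at hyi
      exact absurd (hyi ▸ hy) hi
  have hdom' : ∀ y : X, ∃ i, Sum.inr i ∉ S ∧ ∀ x : X, Sum.inl x ∈ S → (y.1 i : ℕ) ≤ x.1 i := by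
    intro y
    obtain ⟨i, hi⟩ := hdom (Sum.inl y)
    refine ⟨i, fun h => ?_, fun x hx => ?_⟩
    · simpa [slackRank] using hi _ h
    · by_contra! h
      have h1 := hi _ hx
      simp only [slackRank, add_le_add_iff_right] at h1
      exact absurd h1 (not_le.2 (hlt i x y h))
  have hex : ∃ x : X, Sum.inl x ∈ S := by
    obtain ⟨i, hi, -⟩ := hdom' (Classical.arbitrary X)
    obtain ⟨x, hx, -⟩ := hcol i hi
    exact ⟨x, hx⟩
  have hmin : ∀ i, ∃ a : ℕ, (Sum.inr i ∈ S → a = 0) ∧ (∀ x : X, Sum.inl x ∈ S → a ≤ x.1 i) ∧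
      (Sum.inr i ∉ S → ∃ x : X, Sum.inl x ∈ S ∧ a = x.1 i) := by
    intro i
    by_cases hi : Sum.inr i ∈ S
    · exact ⟨0, fun _ => rfl, fun _ _ => Nat.zero_le _, fun h => absurd hi h⟩
    · obtain ⟨x₁, hx₁⟩ := hex
      obtain ⟨x, hx, hxmin⟩ := (Finset.univ.filter fun x : X => Sum.inl x ∈ S).exists_min_image
        (fun x => (x.1 i : ℕ)) ⟨x₁, by simpa using hx₁⟩
      exact ⟨x.1 i, fun h => absurd h hi, fun z hz => hxmin z (by simpa using hz),
        fun _ => ⟨x, by simpa using hx, rfl⟩⟩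
  choose a ha0 hale hamin using hmin
  have hsum : N < ∑ i, a i + n := by
    by_contra! hle
    have hs : ∑ i, (a i + 1) = ∑ i, a i + n := by simp [Finset.sum_add_distrib]
    obtain ⟨y, hy⟩ := hmk ((fun i => a i + 1) + Pi.single ⟨0, hn⟩ (N - (∑ i, a i + n))) (by
      simp only [Pi.add_apply, Finset.sum_add_distrib] at hs ⊢
      rw [hs, Finset.sum_pi_single']
      simp only [Finset.mem_univ, if_true]
      omega)
    obtain ⟨i, hi, hyi⟩ := hdom' y
    obtain ⟨x, hx, hax⟩ := hamin i hi
    have h1 := hyi x hx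
    rw [hy i, ← hax] at h1
    simp only [Pi.add_apply] at h1
    omega
  have hbox : ∀ x : X, Sum.inl x ∈ S → ∀ l, a l ≤ x.1 l ∧ (x.1 l : ℕ) < a l + n := by
    intro x hx l
    refine ⟨hale l x hx, ?_⟩
    have h1 := Finset.add_sum_erase Finset.univ a (Finset.mem_univ l)
    have h2 := Finset.add_sum_erase Finset.univ (fun l => (x.1 l : ℕ)) (Finset.mem_univ l)
    have h3 : ∑ i ∈ Finset.univ.erase l, a i ≤ ∑ i ∈ Finset.univ.erase l, (x.1 i : ℕ) :=
      Finset.sum_le_sum fun i _ => hale i x hx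
    have h4 := x.2
    omega
  obtain ⟨x₀, hx₀⟩ := hex
  refine ⟨a, fun l => x₀.1 l, x₀.2, hbox x₀ hx₀, fun i => ?_⟩
  by_cases hi : Sum.inr i ∈ S
  · exact Or.inl (ha0 i hi)
  · obtain ⟨x, hx, hcx⟩ := hcol i hi
    exact Or.inr ⟨fun l => x.1 l, x.2, hcx, hbox x hx⟩

/-- The **Knaster–Kuratowski–Mazurkiewicz lemma** for closed sets. -/
theorem exists_mem_stdSimplex_forall_mem {n : ℕ} (hn : 0 < n) (C : Fin n → Set (Fin n → ℝ))
    (hC : ∀ i, IsClosed (C i))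
    (hcov : ∀ t ∈ stdSimplex ℝ (Fin n), ∃ i, 0 < t i ∧ t ∈ C i) :
    ∃ t ∈ stdSimplex ℝ (Fin n), ∀ i, t ∈ C i := by
  classical
  have hne : ∀ i, (C i).Nonempty := by
    intro i
    obtain ⟨j, hj, hm⟩ := hcov (Pi.single i 1) (single_mem_stdSimplex ℝ i)
    have : j = i := by
      by_contra h
      simp [Pi.single_eq_of_ne h] at hj
    subst this
    exact ⟨_, hm⟩
  let g : Fin n → (Fin n → ℝ) → ℝ := fun i t => Metric.infDist t (C i)
  have hg : ∀ i, Continuous (g i) := fun i => Metric.continuous_infDist_pt _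
  have hg0 : ∀ i t, 0 ≤ g i t := fun i t => Metric.infDist_nonneg
  let F : Fin n → Set (Fin n → ℝ) := fun i => {t | t i * ∑ j, g j t ≤ g i t}
  have hF : ∀ i, IsClosed (F i) := fun i =>
    isClosed_le ((continuous_apply i).mul (continuous_finsetSum _ fun j _ => hg j)) (hg i)
  have hFne : ∀ i, (F i).Nonempty := fun i => ⟨0, by simpa [F] using hg0 i 0⟩
  let D : (Fin n → ℝ) → ℝ := fun t => ∑ i, Metric.infDist t (F i)
  have hD : Continuous D := continuous_finsetSum _ fun i _ => Metric.continuous_infDist_pt _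
  have hD0 : ∀ t, 0 ≤ D t := fun t => Finset.sum_nonneg fun i _ => Metric.infDist_nonneg
  have happrox : ∀ N : ℕ, 0 < N → ∃ t ∈ stdSimplex ℝ (Fin n), D t ≤ n * (n / N) := by
    intro N hN
    have hN' : (0 : ℝ) < N := Nat.cast_pos.2 hN
    let p : (Fin n → ℕ) → Fin n → ℝ := fun x i => x i / N
    have hp : ∀ x : Fin n → ℕ, ∑ i, x i = N → p x ∈ stdSimplex ℝ (Fin n) := by
      intro x hx
      refine ⟨fun i => by positivity, ?_⟩
      simp only [p]
      rw [← Finset.sum_div, ← Nat.cast_sum, hx, div_self hN'.ne']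
    have hcol : ∀ x : Fin n → ℕ, ∃ i, ∑ l, x l = N → p x ∈ F i := by
      intro x
      by_cases hx : ∑ l, x l = N
      · by_contra! h
        have hlt : ∀ i, g i (p x) < p x i * ∑ j, g j (p x) := fun i => not_le.1 (h i).2
        have h1 : ∑ i, g i (p x) < ∑ i, p x i * ∑ j, g j (p x) :=
          Finset.sum_lt_sum_of_nonempty ⟨⟨0, hn⟩, Finset.mem_univ _⟩ fun i _ => hlt i
        rw [← Finset.sum_mul, (hp x hx).2, one_mul] at h1
        exact lt_irrefl _ h1
      · exact ⟨⟨0, hn⟩, fun h => absurd h hx⟩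
    choose c hc using hcol
    obtain ⟨a, x₀, hx₀, hbox₀, hbox⟩ := exists_box_of_coloring hn N c
    refine ⟨p x₀, hp x₀ hx₀, ?_⟩
    have hnN : (0 : ℝ) ≤ n / N := by positivity
    have hle : ∀ i, Metric.infDist (p x₀) (F i) ≤ n / N := by
      intro i
      rcases hbox i with hai | ⟨x, hx, hcx, hxb⟩
      · have hmem : Function.update (p x₀) i 0 ∈ F i := by simpa [F] using hg0 i _
        refine (Metric.infDist_le_dist_of_mem hmem).trans ((dist_pi_le_iff hnN).2 fun l => ?_)
        by_cases hl : l = i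
        · subst hl
          have h1 : x₀ l ≤ n := by have := hbox₀ l; omega
          have h2 : (x₀ l : ℝ) ≤ n := Nat.cast_le.2 h1
          rw [Function.update_self, Real.dist_eq, sub_zero, abs_of_nonneg (by positivity)]
          exact div_le_div_of_nonneg_right h2 hN'.le
        · rw [Function.update_of_ne hl, dist_self]; exact hnN
      · have hmem : p x ∈ F i := hcx ▸ hc x hx
        refine (Metric.infDist_le_dist_of_mem hmem).trans ((dist_pi_le_iff hnN).2 fun l => ?_)
        obtain ⟨h1, h2⟩ := hbox₀ l
        obtain ⟨h3, h4⟩ := hxb l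
        have h5 : (x₀ l : ℝ) ≤ x l + n := by exact_mod_cast (by omega : x₀ l ≤ x l + n)
        have h6 : (x l : ℝ) ≤ x₀ l + n := by exact_mod_cast (by omega : x l ≤ x₀ l + n)
        simp only [p]
        rw [Real.dist_eq, ← sub_div, abs_div, abs_of_pos hN']
        refine div_le_div_of_nonneg_right (abs_le.2 ⟨?_, ?_⟩) hN'.le <;> linarith
    calc D (p x₀) ≤ ∑ _i : Fin n, (n / N : ℝ) := Finset.sum_le_sum fun i _ => hle i
      _ = n * (n / N) := by simp
  obtain ⟨t, ht, htmin⟩ := (isCompact_stdSimplex ℝ (Fin n)).exists_isMinOn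
    ⟨_, single_mem_stdSimplex ℝ ⟨0, hn⟩⟩ hD.continuousOn
  have hDt : D t ≤ 0 := by
    have hlim : Filter.Tendsto (fun N : ℕ => (n : ℝ) * (n / N)) Filter.atTop (nhds 0) := by
      simpa using (tendsto_const_div_atTop_nhds_zero_nat (n : ℝ)).const_mul (n : ℝ)
    refine ge_of_tendsto hlim ?_
    filter_upwards [Filter.eventually_gt_atTop 0] with N hN
    obtain ⟨t', ht', hle⟩ := happrox N hN
    exact (htmin ht').trans hle
  have htF : ∀ i, t i * ∑ j, g j t ≤ g i t := by
    intro i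
    have h1 : Metric.infDist t (F i) = 0 :=
      (Finset.sum_eq_zero_iff_of_nonneg fun i _ => Metric.infDist_nonneg).1
        (le_antisymm hDt (hD0 t)) i (Finset.mem_univ i)
    exact ((hF i).mem_iff_infDist_zero (hFne i)).2 h1
  have heq : ∀ i, t i * ∑ j, g j t = g i t := by
    intro i
    refine (Finset.sum_eq_sum_iff_of_le fun i _ => htF i).1 ?_ i (Finset.mem_univ i)
    rw [← Finset.sum_mul, ht.2, one_mul]
  obtain ⟨i, hti, hi⟩ := hcov t ht
  have hG : ∑ j, g j t = 0 := by
    have h1 : g i t = 0 := ((hC i).mem_iff_infDist_zero (hne i)).1 hi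
    have h2 := heq i
    rw [h1] at h2
    exact (mul_eq_zero.1 h2).resolve_left hti.ne'
  refine ⟨t, ht, fun j => ((hC j).mem_iff_infDist_zero (hne j)).2 ?_⟩
  have := heq j
  rw [hG, mul_zero] at this
  exact this.symm

/-- The capacities admit a feasible allocation. -/
theorem exists_isFeasible {n m k : ℕ} (cat : Fin m → Fin k) (s : Fin k → ℕ)
    (hcap : ∀ h : Fin k, (Finset.univ.filter (fun j => cat j = h)).card = n * s h) :
    ∃ A : Fin m → Fin n, IsFeasible cat s A := by
  classical
  have he : ∀ h, Nonempty ({j // cat j = h} ≃ Fin n × Fin (s h)) := fun h =>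
    ⟨Fintype.equivOfCardEq (by simp [Fintype.card_subtype, hcap])⟩
  let e := fun h => (he h).some
  refine ⟨fun j => (e (cat j) ⟨j, rfl⟩).1, fun i h => ?_⟩
  have hmem : ∀ j ∈ (bundle (fun j => (e (cat j) ⟨j, rfl⟩).1) i).filter (fun j => cat j = h),
      ∃ hj : cat j = h, (e h ⟨j, hj⟩).1 = i := by
    intro j hj
    obtain ⟨h1, rfl⟩ := Finset.mem_filter.1 hj
    exact ⟨rfl, (Finset.mem_filter.1 h1).2⟩
  calc _ ≤ (Finset.range (s h)).card := ?_
    _ = s h := Finset.card_range _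
  refine Finset.card_le_card_of_injOn
    (fun j => if hj : cat j = h then ((e h ⟨j, hj⟩).2 : ℕ) else 0) ?_ ?_
  · intro j hj
    obtain ⟨hj, -⟩ := hmem j hj
    simp [hj]
  · intro j hj l hl hjl
    obtain ⟨hj, hji⟩ := hmem j hj
    obtain ⟨hl, hli⟩ := hmem l hl
    simp only [hj, hl, dif_pos] at hjl
    have := (e h).injective (Prod.ext (hji.trans hli.symm) (Fin.ext hjl))
    exact congrArg Subtype.val this

/-- Redistributing the bundles of `A` so that agent `i` gets the bundle of agent `σ i`. -/
theorem bundle_perm {n m : ℕ} (A : Fin m → Fin n) (σ : Equiv.Perm (Fin n)) (i : Fin n) :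
    bundle (fun j => σ.symm (A j)) i = bundle A (σ i) := by
  ext j
  simp [bundle, Equiv.symm_apply_eq]

theorem IsFeasible.perm {n m k : ℕ} {cat : Fin m → Fin k} {s : Fin k → ℕ} {A : Fin m → Fin n}
    (hA : IsFeasible cat s A) (σ : Equiv.Perm (Fin n)) :
    IsFeasible cat s (fun j => σ.symm (A j)) := fun i h => by
  rw [bundle_perm]
  exact hA _ _

theorem sum_sum_bundle {n m : ℕ} (ε : Fin n → Fin m → ℝ) (A : Fin m → Fin n) :
    ∑ i, ∑ j ∈ bundle A i, ε i j = ∑ j, ε (A j) j := by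
  simp only [bundle, Finset.sum_filter]
  rw [Finset.sum_comm]
  simp

theorem util_sub_le {n m : ℕ} (u : Fin n → Fin m → ℤ) (A : Fin m → Fin n) (i a b : Fin n) :
    util u A i a - util u A i b ≤ ∑ i, ∑ j, |u i j| := by
  refine le_trans ?_ (Finset.single_le_sum (f := fun i => ∑ j, |u i j|)
    (fun i _ => Finset.sum_nonneg fun j _ => abs_nonneg _) (Finset.mem_univ i))
  simp only [util, bundle, Finset.sum_filter]
  rw [← Finset.sum_sub_distrib]
  refine Finset.sum_le_sum fun j _ => ?_
  have h1 := le_abs_self (u i j)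
  have h2 := neg_abs_le (u i j)
  have h3 := abs_nonneg (u i j)
  split_ifs
  all_goals linarith

/-- If every agent in the nonempty set `{i | p i}` envies somebody, the bundles can be permuted
along an envy cycle, or along an envy path which leaves the set from `i₀`. -/
theorem exists_perm_of_envy {n : ℕ} (p : Fin n → Prop) (i₀ : Fin n) (hi₀ : p i₀)
    (d : Fin n → Fin n → ℤ) (hd0 : ∀ i, d i i = 0) (hd : ∀ i, p i → ∃ i', 0 < d i i') :
    ∃ σ : Equiv.Perm (Fin n), (∀ i, p i → 0 ≤ d i (σ i)) ∧
      ((∃ l, p l ∧ 0 < d l (σ l) ∧ ∀ i, ¬ p i → d i (σ i) = 0) ∨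
        ∃ q, ¬ p q ∧ 0 < d i₀ (σ i₀) ∧ ∀ i, ¬ p i → i ≠ q → d i (σ i) = 0) := by
  classical
  choose! f₀ hf₀ using hd
  let f : Fin n → Fin n := fun i => if p i then f₀ i else i₀
  have hfp : ∀ i, p i → 0 < d i (f i) := fun i hi => by simpa [f, hi] using hf₀ i hi
  have hfq : ∀ i, ¬ p i → f i = i₀ := fun i hi => by simp [f, hi]
  let P := Function.periodicPts f
  have hbij : Set.BijOn f P P := Function.bijOn_periodicPts f
  have hPne : ∃ x, x ∈ P := by
    obtain ⟨a, b, hab, h⟩ := Finite.exists_ne_map_eq_of_infinite fun k : ℕ => f^[k] i₀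
    wlog hlt : a < b generalizing a b
    · exact this b a hab.symm h.symm (by omega)
    refine ⟨f^[a] i₀, b - a, by omega, ?_⟩
    simp only [Function.IsPeriodicPt, Function.IsFixedPt]
    rw [← Function.iterate_add_apply, Nat.sub_add_cancel hlt.le]
    exact h.symm
  let g : Fin n → Fin n := fun i => if i ∈ P then f i else i
  have hgP : ∀ i, i ∈ P → g i = f i := fun i hi => by simp [g, hi]
  have hgn : ∀ i, i ∉ P → g i = i := fun i hi => by simp [g, hi]
  have hginj : Function.Injective g := by
    intro i j hij
    by_cases hi : i ∈ P <;> by_cases hj : j ∈ P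
    · rw [hgP i hi, hgP j hj] at hij
      exact hbij.injOn hi hj hij
    · rw [hgP i hi, hgn j hj] at hij
      exact absurd (hij ▸ hbij.mapsTo hi) hj
    · rw [hgn i hi, hgP j hj] at hij
      exact absurd (hij ▸ hbij.mapsTo hj) hi
    · rwa [hgn i hi, hgn j hj] at hij
  refine ⟨Equiv.ofBijective g (Finite.injective_iff_bijective.1 hginj), fun i hi => ?_, ?_⟩
  · rw [Equiv.ofBijective_apply]
    by_cases hiP : i ∈ P
    · rw [hgP i hiP]; exact (hfp i hi).le
    · rw [hgn i hiP, hd0]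
  simp only [Equiv.ofBijective_apply]
  by_cases hq : ∃ q ∈ P, ¬ p q
  · obtain ⟨q, hqP, hq⟩ := hq
    have hi₀P : i₀ ∈ P := hfq q hq ▸ hbij.mapsTo hqP
    refine Or.inr ⟨q, hq, ?_, fun i hi hiq => ?_⟩
    · rw [hgP i₀ hi₀P]; exact hfp i₀ hi₀
    · have hiP : i ∉ P := fun h => hiq (hbij.injOn h hqP (by rw [hfq i hi, hfq q hq]))
      rw [hgn i hiP, hd0]
  · push Not at hq
    obtain ⟨l, hl⟩ := hPne
    refine Or.inl ⟨l, hq l hl, ?_, fun i hi => ?_⟩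
    · rw [hgP l hl]; exact hfp l (hq l hl)
    · rw [hgn i fun h => hi (hq i h), hd0]

/-- An allocation maximizing `objW` at a point `t` of the simplex is envy-free for some agent in the
support of `t`. -/
theorem exists_envyFreeFor_of_isMax {n m k : ℕ} (hn : 0 < n) (u : Fin n → Fin m → ℤ)
    (cat : Fin m → Fin k) (s : Fin k → ℕ) (K : ℤ) (hK : K = n * (∑ i, ∑ j, |u i j|) + 1)
    (ε : Fin n → Fin m → ℝ) (hε0 : ∀ i j, 0 < ε i j)
    (hεsmall : ∀ i j, ε i j < 1 / ((K : ℝ) * (n : ℝ) ^ 2 * (m : ℝ)))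
    {t : Fin n → ℝ} (ht : t ∈ stdSimplex ℝ (Fin n)) {A : Fin m → Fin n}
    (hA : IsFeasible cat s A)
    (hmax : ∀ A' : Fin m → Fin n, IsFeasible cat s A' → objW u K t ε A' ≤ objW u K t ε A) :
    ∃ i, 0 < t i ∧ EnvyFreeFor u A i := by
  classical
  by_contra! hcon
  have hn' : (0 : ℝ) < n := Nat.cast_pos.2 hn
  obtain ⟨i₀, hi₀⟩ : ∃ i, (1 : ℝ) / n ≤ t i := by
    by_contra! h
    have h1 : ∑ i, t i < ∑ _i : Fin n, (1 : ℝ) / n :=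
      Finset.sum_lt_sum_of_nonempty ⟨⟨0, hn⟩, Finset.mem_univ _⟩ fun i _ => h i
    rw [ht.2] at h1
    simp [hn'.ne'] at h1
  have hi₀pos : 0 < t i₀ := lt_of_lt_of_le (by positivity) hi₀
  obtain ⟨σ, hσ0, hσ⟩ := exists_perm_of_envy (fun i => 0 < t i) i₀ hi₀pos
    (fun i i' => util u A i i' - util u A i i) (fun i => sub_self _) fun i hi => by
      have := hcon i hi
      simp only [EnvyFreeFor, not_forall, not_le] at this
      obtain ⟨i', hi'⟩ := this
      exact ⟨i', sub_pos.2 hi'⟩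
  set U : ℤ := ∑ i, ∑ j, |u i j| with hU
  have hUpos : 1 ≤ U := by
    rcases hσ with ⟨l, -, hl, -⟩ | ⟨q, -, hl, -⟩
    · exact hl.trans_le (util_sub_le u A _ _ _)
    · exact hl.trans_le (util_sub_le u A _ _ _)
  have hm : 0 < m := by
    rcases Nat.eq_zero_or_pos m with rfl | h
    · simp [hU] at hUpos
    · exact h
  have hm' : (0 : ℝ) < m := Nat.cast_pos.2 hm
  have hU' : (1 : ℝ) ≤ U := by exact_mod_cast hUpos
  have hK' : (K : ℝ) = n * U + 1 := by rw [hK]; push_cast; ring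
  have hKn : (0 : ℝ) ≤ K - n := by rw [hK']; nlinarith
  have hKpos : (0 : ℝ) < K := by linarith
  let w : Fin n → ℝ := fun i => 1 + ((K : ℝ) - n) * t i
  have hw1 : ∀ i, 1 ≤ w i := fun i => by
    have := mul_nonneg hKn (ht.1 i)
    simp only [w]; linarith
  have hwi₀ : U + 1 / (n : ℝ) ≤ w i₀ := by
    have h1 := mul_le_mul_of_nonneg_left hi₀ hKn
    have h2 : ((K : ℝ) - n) * (1 / n) = U + 1 / n - 1 := by
      rw [hK']; field_simp
    simp only [w]; linarith
  let d : Fin n → ℝ := fun i => ((util u A i (σ i) - util u A i i : ℤ) : ℝ)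
  have hterm : ∀ i, 0 < t i → 0 ≤ w i * d i := fun i hi =>
    mul_nonneg (zero_le_one.trans (hw1 i)) (Int.cast_nonneg (hσ0 i hi))
  have hpos : ∀ i, 0 < util u A i (σ i) - util u A i i → w i ≤ w i * d i := fun i hi =>
    le_mul_of_one_le_right (zero_le_one.trans (hw1 i)) (Int.cast_one_le_of_pos hi)
  have hgain : 1 / (n : ℝ) ≤ ∑ i, w i * d i := by
    rcases hσ with ⟨l, hl, hdl, hz⟩ | ⟨q, hq, hdi₀, hz⟩
    · have hall : ∀ i, 0 ≤ w i * d i := fun i => by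
        by_cases hi : 0 < t i
        · exact hterm i hi
        · simp only [d, hz i hi, Int.cast_zero, mul_zero, le_refl]
      calc 1 / (n : ℝ) ≤ 1 := by
            rw [div_le_one hn']; exact_mod_cast hn
        _ ≤ w l * d l := (hw1 l).trans (hpos l hdl)
        _ ≤ _ := Finset.single_le_sum (fun i _ => hall i) (Finset.mem_univ l)
    · have hqi₀ : i₀ ≠ q := fun h => hq (h ▸ hi₀pos)
      have hrest : ∀ i, i ≠ q → 0 ≤ w i * d i := fun i hiq => by
        by_cases hi : 0 < t i
        · exact hterm i hi
        · simp only [d, hz i hi hiq, Int.cast_zero, mul_zero, le_refl]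
      have htq : t q = 0 := le_antisymm (not_lt.1 hq) (ht.1 q)
      have hdq : -(U : ℝ) ≤ w q * d q := by
        have h1 := util_sub_le u A q q (σ q)
        rw [← hU] at h1
        have h2 : -U ≤ util u A q (σ q) - util u A q q := by linarith
        simp only [w, d, htq, mul_zero, add_zero, one_mul]
        exact_mod_cast h2
      rw [← Finset.add_sum_erase _ _ (Finset.mem_univ q)]
      have h3 : w i₀ * d i₀ ≤ ∑ i ∈ Finset.univ.erase q, w i * d i :=
        Finset.single_le_sum (f := fun i => w i * d i)
          (fun i hi => hrest i (Finset.mem_erase.1 hi).1)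
          (Finset.mem_erase.2 ⟨hqi₀, Finset.mem_univ _⟩)
      have h4 := hpos i₀ hdi₀
      linarith
  have hle := hmax _ (hA.perm σ)
  have hobj : ∀ B : Fin m → Fin n, objW u K t ε B =
      (1 / (K : ℝ)) * ∑ i, w i * (util u B i i : ℝ) + ∑ j, ε (B j) j := fun B => by
    rw [← sum_sum_bundle]; rfl
  have hutil : ∀ i, util u (fun j => σ.symm (A j)) i i = util u A i (σ i) := fun i => by
    simp only [util, bundle_perm]
  rw [hobj, hobj] at hle
  simp only [hutil] at hle
  have hsub : ∑ i, w i * d i =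
      ∑ i, w i * (util u A i (σ i) : ℝ) - ∑ i, w i * (util u A i i : ℝ) := by
    rw [← Finset.sum_sub_distrib]
    refine Finset.sum_congr rfl fun i _ => ?_
    simp only [d]; push_cast; ring
  have hnem : (Finset.univ : Finset (Fin m)).Nonempty := ⟨⟨0, hm⟩, Finset.mem_univ _⟩
  have hE0 : 0 < ∑ j, ε (σ.symm (A j)) j := Finset.sum_pos (fun j _ => hε0 _ _) hnem
  have hE1 : ∑ j, ε (A j) j < 1 / (K * (n : ℝ) ^ 2) := by
    calc ∑ j, ε (A j) j < ∑ _j : Fin m, 1 / ((K : ℝ) * (n : ℝ) ^ 2 * (m : ℝ)) :=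
          Finset.sum_lt_sum_of_nonempty hnem fun j _ => hεsmall _ _
      _ = _ := by
          rw [Finset.sum_const, Finset.card_univ, Fintype.card_fin, nsmul_eq_mul]
          field_simp
  have hE2 : 1 / (K * (n : ℝ) ^ 2) ≤ 1 / K * (1 / n) := by
    rw [div_mul_div_comm, one_mul]
    have h1 : (1 : ℝ) ≤ n := by exact_mod_cast hn
    refine one_div_le_one_div_of_le (by positivity) ?_
    exact mul_le_mul_of_nonneg_left (by nlinarith) hKpos.le
  have hfin := mul_le_mul_of_nonneg_left hgain (by positivity : (0 : ℝ) ≤ 1 / K)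
  rw [hsub, mul_sub] at hfin
  linarith

/-- There is a point `t*` of the standard simplex such that for every agent `i` some feasible
allocation maximizing `W_{t*}` over all feasible allocations is envy-free for agent `i`. -/
theorem statement6 (n m k : ℕ) (hn : 0 < n)
    (u : Fin n → Fin m → ℤ) (cat : Fin m → Fin k) (s : Fin k → ℕ)
    (hcap : ∀ h : Fin k, (Finset.univ.filter (fun j => cat j = h)).card = n * s h)
    (K : ℤ) (hK : K = n * (∑ i, ∑ j, |u i j|) + 1)
    (ε : Fin n → Fin m → ℝ) (hε0 : ∀ i j, 0 < ε i j)
    (hεsmall : ∀ i j, ε i j < 1 / ((K : ℝ) * (n : ℝ) ^ 2 * (m : ℝ))) :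
    ∃ t : Fin n → ℝ, (∀ i, 0 ≤ t i) ∧ (∑ i, t i = 1) ∧
      ∀ i : Fin n, ∃ A : Fin m → Fin n,
        IsFeasible cat s A ∧
        (∀ A' : Fin m → Fin n, IsFeasible cat s A' → objW u K t ε A' ≤ objW u K t ε A) ∧
        EnvyFreeFor u A i := by
  classical
  let C : Fin n → Set (Fin n → ℝ) := fun i => {t | ∃ A : Fin m → Fin n, IsFeasible cat s A ∧
    (∀ A' : Fin m → Fin n, IsFeasible cat s A' → objW u K t ε A' ≤ objW u K t ε A) ∧
    EnvyFreeFor u A i}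
  have hcont : ∀ A : Fin m → Fin n, Continuous fun t => objW u K t ε A := by
    intro A
    unfold objW
    fun_prop
  have hC : ∀ i, IsClosed (C i) := by
    intro i
    have hCi : C i = ⋃ A ∈ {A : Fin m → Fin n | IsFeasible cat s A ∧ EnvyFreeFor u A i},
        ⋂ A' ∈ {A' : Fin m → Fin n | IsFeasible cat s A'},
          {t | objW u K t ε A' ≤ objW u K t ε A} := by
      ext t
      simp only [C, Set.mem_ofPred_eq, Set.mem_iUnion, Set.mem_iInter, exists_prop]
      exact exists_congr fun A => by tauto
    rw [hCi]
    exact (Set.toFinite _).isClosed_biUnion fun A _ =>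
      isClosed_biInter fun A' _ => isClosed_le (hcont A') (hcont A)
  obtain ⟨t, ht, hmem⟩ := exists_mem_stdSimplex_forall_mem hn C hC fun t ht => by
    obtain ⟨A₀, hA₀⟩ := exists_isFeasible cat s hcap
    obtain ⟨A, hA, hmax⟩ := (Finset.univ.filter fun A => IsFeasible cat s A).exists_max_image
      (objW u K t ε) ⟨A₀, by simpa using hA₀⟩
    have hA' : IsFeasible cat s A := (Finset.mem_filter.1 hA).2
    have hmax' : ∀ A' : Fin m → Fin n, IsFeasible cat s A' →
        objW u K t ε A' ≤ objW u K t ε A := fun A' h => hmax A' (by simpa using h)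
    obtain ⟨i, hi, hEF⟩ :=
      exists_envyFreeFor_of_isMax hn u cat s K hK ε hε0 hεsmall ht hA' hmax'
    exact ⟨i, hi, A, hA', hmax', hEF⟩
  exact ⟨t, ht.1, ht.2, hmem⟩
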